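/- Let C be a pretriangulated category satisfying the octahedral axiom (Mathlib's CategoryTheory.IsTriangulated) and S a set of objects of C. If A ⟶ B ⟶ C' ⟶ A⟦1⟧ is a distinguished triangle and both A and C' admit S-towers, then B admits an S-tower. (Closure of the class of iterated extensions of shifts of objects of S under forming extensions; this is the key step in the nontrivial direction of Proposition 2.13 of the paper.) -/

import Mathlib

open CategoryTheory CategoryTheory.Limits CategoryTheory.Pretriangulated

universe v u

variable {C : Type u} [Category.{v} C] [HasZeroObject C] [HasShift C ℤ]
  [Preadditive C] [∀ n : ℤ, (shiftFunctor C n).Additive] [Pretriangulated C]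

/-- An object `X` admits an `S`-tower if there are objects `X = X₀, X₁, …, Xₙ`
with `Xₙ` (isomorphic to) a zero object, and for each `0 ≤ i ≤ n - 1` an integer `aᵢ`,
an object `Dᵢ ∈ S` and a distinguished triangle `Dᵢ⟦aᵢ⟧ ⟶ X_{i+1} ⟶ Xᵢ ⟶ (Dᵢ⟦aᵢ⟧)⟦1⟧`. -/
def HasTower (S : Set C) (X : C) : Prop :=
  ∃ (n : ℕ) (Y : Fin (n + 1) → C), Y 0 = X ∧ IsZero (Y (Fin.last n)) ∧
    ∀ i : Fin n, ∃ (a : ℤ) (D : C), D ∈ S ∧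
      ∃ (f : (D⟦a⟧) ⟶ Y i.succ) (g : Y i.succ ⟶ Y i.castSucc)
        (h : Y i.castSucc ⟶ (D⟦a⟧)⟦(1 : ℤ)⟧),
        Triangle.mk f g h ∈ distTriang C

lemma mk_mem_distTriang_of_iso₃ {X Y Z Z' : C} {f : X ⟶ Y} {g : Y ⟶ Z} {h : Z ⟶ X⟦(1 : ℤ)⟧}
    (hT : Triangle.mk f g h ∈ distTriang C) (e : Z ≅ Z') :
    Triangle.mk f (g ≫ e.hom) (e.inv ≫ h) ∈ distTriang C := by
  have h₁ : f ≫ 𝟙 Y = 𝟙 X ≫ f := by simp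
  have h₂ : (g ≫ e.hom) ≫ e.inv = 𝟙 Y ≫ g := by simp
  have h₃ : (e.inv ≫ h) ≫ (𝟙 X)⟦(1 : ℤ)⟧' = e.inv ≫ h := by simp
  exact isomorphic_distinguished _ hT _
    (Triangle.isoMk _ _ (Iso.refl X) (Iso.refl Y) e.symm h₁ h₂ h₃)

namespace HasTower

variable {S : Set C}

lemma of_isZero {X : C} (hX : IsZero X) : HasTower S X :=
  ⟨0, fun _ => X, rfl, hX, fun i => i.elim0⟩

/-- A tower for `X₁` can be extended by one step to a tower for `X`. -/
lemma cons {D X₁ X : C} {a : ℤ} (hD : D ∈ S) {f : D⟦a⟧ ⟶ X₁} {g : X₁ ⟶ X}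
    {h : X ⟶ (D⟦a⟧)⟦(1 : ℤ)⟧} (hT : Triangle.mk f g h ∈ distTriang C)
    (hX₁ : HasTower S X₁) : HasTower S X := by
  obtain ⟨n, Y, rfl, hz, hs⟩ := hX₁
  refine ⟨n + 1, Fin.cons X Y, rfl, hz, fun i => ?_⟩
  cases i using Fin.cases with
  | zero => exact ⟨a, D, hD, f, g, h, hT⟩
  | succ i => exact hs i

/-- Induction along a tower, from its zero end upwards. -/
lemma induction {P : C → Prop} (zero : ∀ X, IsZero X → P X)
    (step : ∀ (D X₁ X : C) (a : ℤ) (f : D⟦a⟧ ⟶ X₁) (g : X₁ ⟶ X)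
      (h : X ⟶ (D⟦a⟧)⟦(1 : ℤ)⟧), D ∈ S → Triangle.mk f g h ∈ distTriang C → P X₁ → P X)
    {X : C} (hX : HasTower S X) : P X := by
  obtain ⟨n, Y, rfl, hz, hs⟩ := hX
  refine Fin.reverseInduction (motive := fun i => P (Y i)) (zero _ hz) (fun i hi => ?_) 0
  obtain ⟨a, D, hD, f, g, h, hT⟩ := hs i
  exact step D _ _ a f g h hD hT hi

lemma of_iso {X X' : C} (hX : HasTower S X) (e : X ≅ X') : HasTower S X' := by
  obtain ⟨n, Y, rfl, hz, hs⟩ := hX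
  cases n with
  | zero => exact of_isZero (hz.of_iso e.symm)
  | succ n =>
    obtain ⟨a, D, hD, f, g, h, hT⟩ := hs 0
    exact cons hD (mk_mem_distTriang_of_iso₃ hT e)
      ⟨n, fun i => Y i.succ, rfl, hz, fun i => hs i.succ⟩

end HasTower

/-- Given distinguished triangles `A ⟶ B ⟶ X ⟶ A⟦1⟧` and `D ⟶ X₁ ⟶ X ⟶ D⟦1⟧`, there is an
object `B₁` (a homotopy pullback of `B` and `X₁` over `X`) which is both an extension of `X₁`
by `A` and of `B` by `D`. -/
lemma exists_distTriang_pullback [IsTriangulated C] {A B X D X₁ : C}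
    {f : A ⟶ B} {g : B ⟶ X} {h : X ⟶ A⟦(1 : ℤ)⟧} (hT : Triangle.mk f g h ∈ distTriang C)
    {f' : D ⟶ X₁} {g' : X₁ ⟶ X} {h' : X ⟶ D⟦(1 : ℤ)⟧}
    (hT' : Triangle.mk f' g' h' ∈ distTriang C) :
    ∃ (B₁ : C) (i : A ⟶ B₁) (p : B₁ ⟶ X₁) (d : X₁ ⟶ A⟦(1 : ℤ)⟧)
      (j : D ⟶ B₁) (q : B₁ ⟶ B) (e : B ⟶ D⟦(1 : ℤ)⟧),
      Triangle.mk i p d ∈ distTriang C ∧ Triangle.mk j q e ∈ distTriang C := by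
  have h₂₃ := inv_rot_of_distTriang _ hT
  have h₁₂ := inv_rot_of_distTriang _ (inv_rot_of_distTriang _ hT')
  obtain ⟨B₁, v, w, h₁₃⟩ := distinguished_cocone_triangle
    ((Triangle.mk f' g' h').invRotate.invRotate.mor₁ ≫ (Triangle.mk f g h).invRotate.mor₁)
  exact ⟨B₁, _, _, _, _, _, _,
    mk_mem_distTriang_of_iso₃ (rot_of_distTriang _ h₁₃) ((shiftEquiv C (1 : ℤ)).counitIso.app X₁),
    (Triangulated.someOctahedron rfl h₁₂ h₂₃ h₁₃).mem⟩

/-- If `A ⟶ B ⟶ C' ⟶ A⟦1⟧` is a distinguished triangle and both `A` and `C'` admit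
`S`-towers, then `B` admits an `S`-tower: the class of iterated extensions of shifts of
objects of `S` is closed under forming extensions. -/
theorem hasTower_of_distTriang [IsTriangulated C] (S : Set C)
    (A B C' : C) (f : A ⟶ B) (g : B ⟶ C') (h : C' ⟶ A⟦(1 : ℤ)⟧)
    (hT : Triangle.mk f g h ∈ distTriang C)
    (hA : HasTower S A) (hC : HasTower S C') : HasTower S B := by
  revert B f g h
  refine HasTower.induction (P := fun X => ∀ (B : C) (f : A ⟶ B) (g : B ⟶ X)
    (h : X ⟶ A⟦(1 : ℤ)⟧), Triangle.mk f g h ∈ distTriang C → HasTower S B) ?_ ?_ hC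
  · intro X hX B f g h hT
    have : IsIso f := (Triangle.isZero₃_iff_isIso₁ _ hT).1 hX
    exact hA.of_iso (asIso f)
  · intro D X₁ X a f' g' h' hD hT' ih B f g h hT
    obtain ⟨B₁, i, p, d, j, q, e, hB₁, hB⟩ := exists_distTriang_pullback hT hT'
    exact .cons hD hB (ih B₁ i p d hB₁)
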